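/- Let π be a strictly positive, twice continuously differentiable probability density on ℝ^d and let i ≠ j be indices. If ∂_i ∂_j log π(z) = 0 for every z ∈ ℝ^d, then there exist strictly positive functions f, g : ℝ^{d−1} → (0,∞) such that π(z) = f(z_{-j}) · g(z_{-i}) for all z ∈ ℝ^d, where z_{-j} ∈ ℝ^{d−1} denotes z with its j-th coordinate removed and z_{-i} denotes z with its i-th coordinate removed. Consequently, Z_i and Z_j are conditionally independent given Z_{-ij} under π. -/

import Mathlib

open MeasureTheory

/-- The partial derivative of `f : ℝ^d → ℝ` in the `i`-th coordinate direction. -/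
noncomputable def pd {d : ℕ} (i : Fin d) (f : (Fin d → ℝ) → ℝ) (z : Fin d → ℝ) : ℝ :=
  deriv (fun t => f (Function.update z i t)) (z i)

/-- The partial derivative of a differentiable function is its derivative in the direction of the
corresponding basis vector. -/
lemma pd_eq_fderiv {d : ℕ} (i : Fin d) {f : (Fin d → ℝ) → ℝ} (hf : Differentiable ℝ f)
    (z : Fin d → ℝ) : pd i f z = fderiv ℝ f z (Pi.single i 1) := by
  have h : HasFDerivAt f (fderiv ℝ f z) (Function.update z i (z i)) := by
    rw [Function.update_eq_self]
    exact (hf z).hasFDerivAt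
  exact (h.comp_hasDerivAt (z i) (hasDerivAt_update z i (z i))).deriv

lemma ContDiff.pd {d : ℕ} {m n : WithTop ℕ∞} (i : Fin d) {f : (Fin d → ℝ) → ℝ}
    (hf : ContDiff ℝ n f) (hmn : m + 1 ≤ n) : ContDiff ℝ m (pd i f) := by
  have hd : Differentiable ℝ f :=
    (hf.of_le (le_trans le_add_self hmn)).differentiable one_ne_zero
  rw [funext (pd_eq_fderiv i hd)]
  exact (hf.fderiv_right hmn).clm_apply contDiff_const

lemma differentiable_update {d : ℕ} (i : Fin d) (z : Fin d → ℝ) :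
    Differentiable ℝ (fun t : ℝ => Function.update z i t) :=
  fun t => (hasDerivAt_update z i t).differentiableAt

/-- A differentiable function with vanishing `i`-th partial derivative does not depend on the
`i`-th coordinate. -/
lemma apply_update_eq_of_pd_eq_zero {d : ℕ} (i : Fin d) {f : (Fin d → ℝ) → ℝ}
    (hf : Differentiable ℝ f) (h : ∀ z, pd i f z = 0) (z : Fin d → ℝ) (t : ℝ) :
    f (Function.update z i t) = f z := by
  have hconst := is_const_of_deriv_eq_zero (f := fun t => f (Function.update z i t))
    (hf.comp (differentiable_update i z))
    (fun s => by simpa [pd] using h (Function.update z i s)) t (z i)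
  simpa using hconst

/-- If the mixed partial derivative of a `C^2` function vanishes, so do its mixed second
differences. -/
lemma add_update_update_eq_of_pd_pd_eq_zero {d : ℕ} {i j : Fin d} (hij : i ≠ j)
    {f : (Fin d → ℝ) → ℝ} (hf : ContDiff ℝ 2 f) (h : ∀ z, pd i (pd j f) z = 0)
    (z : Fin d → ℝ) (s t : ℝ) :
    f z + f (Function.update (Function.update z i s) j t) =
      f (Function.update z j t) + f (Function.update z i s) := by
  have hd : Differentiable ℝ f := hf.differentiable two_ne_zero
  have hpd : Differentiable ℝ (pd j f) :=
    (ContDiff.pd (m := 1) j hf (by norm_num [one_add_one_eq_two])).differentiable one_ne_zero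
  have hline : ∀ w : Fin d → ℝ, Differentiable ℝ (fun t => f (Function.update w j t)) :=
    fun w => hd.comp (differentiable_update j w)
  have hconst := is_const_of_deriv_eq_zero
    (f := fun t => f (Function.update z j t) - f (Function.update (Function.update z i s) j t))
    ((hline z).sub (hline _)) (fun t => by
      rw [deriv_fun_sub (hline z t) (hline _ t), sub_eq_zero]
      have := apply_update_eq_of_pd_eq_zero i hpd h (Function.update z j t) s
      rw [← Function.update_comm hij] at this
      simpa [pd] using this.symm) t (z j)
  have hj : Function.update (Function.update z i s) j (z j) = Function.update z i s := by
    rw [Function.update_eq_self_iff, Function.update_of_ne hij.symm]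
  simp only [Function.update_eq_self, hj] at hconst
  linarith

/-- Let `π` be a strictly positive, twice continuously differentiable probability
density on `ℝ^d` and `i ≠ j`. If `∂_i ∂_j log π(z) = 0` for every `z`, then there exist
strictly positive functions `f, g` such that `π(z) = f(z_{-j}) · g(z_{-i})` (here formalized
as: `f` does not depend on the `j`-th coordinate and `g` does not depend on the `i`-th
coordinate). Consequently, `Z_i` and `Z_j` are conditionally independent given `Z_{-ij}`:
`π(z_i, z_j | z_{-ij}) = π(z_i | z_{-ij}) π(z_j | z_{-ij})` for all `z`. -/
theorem stmt_2 {d : ℕ} (π : (Fin d → ℝ) → ℝ)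
    (hpos : ∀ z, 0 < π z)
    (hsmooth : ContDiff ℝ 2 π)
    (hprob : (∫ z : Fin d → ℝ, π z) = 1)
    (i j : Fin d) (hij : i ≠ j)
    (hzero : ∀ z : Fin d → ℝ, pd i (pd j (fun u => Real.log (π u))) z = 0) :
    (∃ f g : (Fin d → ℝ) → ℝ,
      (∀ z, 0 < f z) ∧ (∀ z, 0 < g z) ∧
      (∀ z t, f (Function.update z j t) = f z) ∧
      (∀ z t, g (Function.update z i t) = g z) ∧
      (∀ z, π z = f z * g z)) ∧
    (∀ z : Fin d → ℝ,
      π z / (∫ p : ℝ × ℝ, π (Function.update (Function.update z i p.1) j p.2)) =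
        ((∫ t, π (Function.update z j t)) /
            ∫ p : ℝ × ℝ, π (Function.update (Function.update z i p.1) j p.2)) *
          ((∫ s, π (Function.update z i s)) /
            ∫ p : ℝ × ℝ, π (Function.update (Function.update z i p.1) j p.2))) := by
  have hlog : ContDiff ℝ 2 (fun u => Real.log (π u)) := hsmooth.log fun z => (hpos z).ne'
  have hfac : ∃ f g : (Fin d → ℝ) → ℝ,
      (∀ z, 0 < f z) ∧ (∀ z, 0 < g z) ∧
      (∀ z t, f (Function.update z j t) = f z) ∧
      (∀ z t, g (Function.update z i t) = g z) ∧
      (∀ z, π z = f z * g z) := by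
    refine ⟨fun z => π (Function.update z j 0),
      fun z => π (Function.update z i 0) / π (Function.update (Function.update z i 0) j 0),
      fun z => hpos _, fun z => div_pos (hpos _) (hpos _), fun z t => by simp,
      fun z t => by simp, fun z => ?_⟩
    have h := add_update_update_eq_of_pd_pd_eq_zero hij hlog hzero z 0 0
    rw [← Real.log_mul (hpos _).ne' (hpos _).ne', ← Real.log_mul (hpos _).ne' (hpos _).ne'] at h
    have h' := Real.log_injOn_pos (mul_pos (hpos _) (hpos _)) (mul_pos (hpos _) (hpos _)) h
    rw [← mul_div_assoc, eq_div_iff (hpos _).ne', h']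
  refine ⟨hfac, fun z => ?_⟩
  obtain ⟨f, g, -, -, hf, hg, hπ⟩ := hfac
  have hjoint : (∫ p : ℝ × ℝ, π (Function.update (Function.update z i p.1) j p.2)) =
      (∫ s, f (Function.update z i s)) * ∫ t, g (Function.update z j t) := by
    rw [Measure.volume_eq_prod, ← integral_prod_mul]
    refine integral_congr_ae (Filter.Eventually.of_forall fun p => ?_)
    simp only [hπ, hf]
    rw [Function.update_comm hij, hg]
  have hmarg_i : (∫ t, π (Function.update z j t)) = f z * ∫ t, g (Function.update z j t) := by
    simp only [hπ, hf, integral_const_mul]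
  have hmarg_j : (∫ s, π (Function.update z i s)) = (∫ s, f (Function.update z i s)) * g z := by
    simp only [hπ, hg, integral_mul_const]
  rw [hjoint, hmarg_i, hmarg_j, hπ z]
  rcases eq_or_ne (∫ s, f (Function.update z i s)) 0 with hA | hA
  · simp [hA]
  rcases eq_or_ne (∫ t, g (Function.update z j t)) 0 with hB | hB
  · simp [hB]
  field_simp
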